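/- Let 𝒪 ⊂ ℝ^{m−k} × ℝ^n be open, φ : 𝒪 → ℝᵏ, and A₀ ∈ 𝒪. Suppose there are an open set U ⊂ G with Φ(A₀) ∈ U and f ∈ C¹_G(U, ℝᵏ) such that graph(φ) ∩ U = {P ∈ U : f(P) = 0} and the k×k matrix M₁(Q) := (X_i f_j(Q))_{j,i=1,…,k} is invertible for every Q ∈ U. Then φ is intrinsic Lipschitz near A₀: there exist δ > 0 and C_L ≥ 0 such that |φ(B) − φ(A)|_{ℝᵏ} ≤ C_L·σ_φ(A,B) for all A, B ∈ 𝒪 with N(i(A₀)⁻¹·i(A)) < δ and N(i(A₀)⁻¹·i(B)) < δ. -/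

import Mathlib

noncomputable section

open Set Filter Topology MeasureTheory

namespace Carnot

/-- Euclidean norm on `Fin d → ℝ`. -/
def enorm {d : ℕ} (x : Fin d → ℝ) : ℝ := Real.sqrt (∑ i, (x i) ^ 2)

/-- The underlying set of the Carnot group `G = ℝ^m × ℝ^n` of class `𝓑`. -/
abbrev G (m n : ℕ) := (Fin m → ℝ) × (Fin n → ℝ)

/-- Points of the normal complement `W`, identified with `ℝ^(m-k) × ℝ^n`. -/
abbrev W (m n k : ℕ) := (Fin (m - k) → ℝ) × (Fin n → ℝ)

/-- The group law of the Carnot group of class `𝓑` associated with the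
skew-symmetric matrices `b s`:
`(x,y)·(x',y') = (x + x', y + y' + ½⟨Bx,x'⟩)`. -/
def gmul {m n : ℕ} (b : Fin n → Matrix (Fin m) (Fin m) ℝ) (P Q : G m n) : G m n :=
  (P.1 + Q.1, fun s => P.2 s + Q.2 s + (1 / 2) * ∑ i, ∑ j, b s i j * P.1 j * Q.1 i)

/-- The group inverse `(x,y)⁻¹ = (-x,-y)`. -/
def ginv {m n : ℕ} (P : G m n) : G m n := (-P.1, -P.2)

/-- The homogeneous quasi-norm `N(x,y) = |x| + |y|^(1/2)`. -/
def qnorm {m n : ℕ} (P : G m n) : ℝ := enorm P.1 + Real.sqrt (enorm P.2)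

/-- Open ball for the quasi-norm: `U(P,r) = {Q : N(P⁻¹·Q) < r}`. -/
def ball (m n : ℕ) (b : Fin n → Matrix (Fin m) (Fin m) ℝ) (P : G m n) (r : ℝ) : Set (G m n) :=
  {Q | qnorm (gmul b (ginv P) Q) < r}

/-- The embedding `i : ℝ^(m-k) × ℝ^n → G`, `i(a,α) = (0,…,0,a,α)`. -/
def embW (m n k : ℕ) (A : W m n k) : G m n :=
  (fun j => if h : (j : ℕ) < k then 0 else A.1 ⟨(j : ℕ) - k, by have := j.isLt; omega⟩, A.2)

/-- The embedding of `ℝ^k` as the horizontal subgroup `H`, `v ↦ (v,0,…,0)`. -/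
def embH (m n k : ℕ) (v : Fin k → ℝ) : G m n :=
  (fun j => if h : (j : ℕ) < k then v ⟨(j : ℕ), h⟩ else 0, 0)

/-- The graph map `Φ(A) = i(A)·φ̂(A)`. -/
def graphMap (m n k : ℕ) (b : Fin n → Matrix (Fin m) (Fin m) ℝ)
    (φ : W m n k → Fin k → ℝ) (A : W m n k) : G m n :=
  gmul b (embW m n k A) (embH m n k (φ A))

/-- `N(i(A)⁻¹·i(B))`. -/
def dW (m n k : ℕ) (b : Fin n → Matrix (Fin m) (Fin m) ℝ) (A B : W m n k) : ℝ :=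
  qnorm (gmul b (ginv (embW m n k A)) (embW m n k B))

/-- The graph quasi-distance `σ_φ(A,B) = N(φ̂(A)⁻¹·i(A)⁻¹·i(B)·φ̂(A))`. -/
def sigma (m n k : ℕ) (b : Fin n → Matrix (Fin m) (Fin m) ℝ)
    (φ : W m n k → Fin k → ℝ) (A B : W m n k) : ℝ :=
  qnorm (gmul b (gmul b (gmul b (ginv (embH m n k (φ A))) (ginv (embW m n k A)))
    (embW m n k B)) (embH m n k (φ A)))

/-- The matrix `M` satisfies the uniform intrinsic differentiability condition of `φ`
at `A₀ ∈ 𝒪`. -/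
def UID (m n k : ℕ) (b : Fin n → Matrix (Fin m) (Fin m) ℝ) (O : Set (W m n k))
    (φ : W m n k → Fin k → ℝ) (A₀ : W m n k) (M : Matrix (Fin k) (Fin (m - k)) ℝ) : Prop :=
  ∀ ε > 0, ∃ r > 0, ∀ A ∈ O, ∀ B ∈ O,
    dW m n k b A₀ A < r → dW m n k b A B < r → 0 < dW m n k b A B →
    enorm (fun j => φ B j - φ A j - ∑ i, M j i * (B.1 i - A.1 i)) ≤ ε * sigma m n k b φ A B

/-- `f : U → ℝ^k` is of class `C¹_G` with (continuous) horizontal Jacobian `gradf`. -/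
def C1G (m n k : ℕ) (b : Fin n → Matrix (Fin m) (Fin m) ℝ) (U : Set (G m n))
    (f : G m n → Fin k → ℝ) (gradf : G m n → Matrix (Fin k) (Fin m) ℝ) : Prop :=
  ContinuousOn f U ∧ ContinuousOn gradf U ∧
  ∀ P ∈ U, ∀ ε > 0, ∃ r > 0, ∀ Q ∈ U,
    qnorm (gmul b (ginv P) Q) < r →
    enorm (fun j => f Q j - f P j - ∑ i, gradf P j i * (Q.1 i - P.1 i)) ≤
      ε * qnorm (gmul b (ginv P) Q)

/-- The square block `M₁(Q) = (X_i f_j(Q))_{j,i=1,…,k}` of the horizontal Jacobian. -/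
def M1 (m n k : ℕ) (hk : k ≤ m) (gradf : G m n → Matrix (Fin k) (Fin m) ℝ) (Q : G m n) :
    Matrix (Fin k) (Fin k) ℝ :=
  Matrix.of fun j i => gradf Q j (Fin.castLE hk i)

/-- The block `M₂(Q) = (X_{k+i} f_j(Q))_{j=1,…,k; i=1,…,m-k}` of the horizontal Jacobian. -/
def M2 (m n k : ℕ) (gradf : G m n → Matrix (Fin k) (Fin m) ℝ) (Q : G m n) :
    Matrix (Fin k) (Fin (m - k)) ℝ :=
  Matrix.of fun j i => gradf Q j ⟨k + (i : ℕ), by have := i.isLt; omega⟩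

section NormComparison

variable {d m n : ℕ}

lemma norm_le_enorm (x : Fin d → ℝ) : ‖x‖ ≤ enorm x := by
  refine (pi_norm_le_iff_of_nonneg (Real.sqrt_nonneg _)).2 fun i => ?_
  rw [Real.norm_eq_abs, ← Real.sqrt_sq_eq_abs]
  exact Real.sqrt_le_sqrt (Finset.single_le_sum (f := fun i => x i ^ 2)
    (fun i _ => sq_nonneg _) (Finset.mem_univ i))

lemma enorm_nonneg (x : Fin d → ℝ) : 0 ≤ enorm x := Real.sqrt_nonneg _

lemma enorm_le_mul_norm (x : Fin d → ℝ) : enorm x ≤ d * ‖x‖ := by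
  refine Real.sqrt_le_iff.2 ⟨by positivity, ?_⟩
  calc ∑ i, x i ^ 2 ≤ ∑ _i : Fin d, ‖x‖ ^ 2 := by
        refine Finset.sum_le_sum fun i _ => ?_
        rw [← sq_abs, ← Real.norm_eq_abs]
        gcongr
        exact norm_le_pi_norm x i
    _ = d * ‖x‖ ^ 2 := by simp
    _ ≤ (d * d) * ‖x‖ ^ 2 := by
        gcongr
        exact_mod_cast Nat.le_mul_self d
    _ = (d * ‖x‖) ^ 2 := by ring

lemma continuous_enorm : Continuous (enorm : (Fin d → ℝ) → ℝ) := by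
  unfold enorm
  fun_prop

@[simp] lemma enorm_zero : enorm (0 : Fin d → ℝ) = 0 := by simp [enorm]

lemma enorm_smul (t : ℝ) (x : Fin d → ℝ) : enorm (t • x) = |t| * enorm x := by
  simp only [enorm, Pi.smul_apply, smul_eq_mul, mul_pow, ← Finset.mul_sum]
  rw [Real.sqrt_mul (sq_nonneg t), Real.sqrt_sq_eq_abs]

lemma qnorm_nonneg (P : G m n) : 0 ≤ qnorm P :=
  add_nonneg (enorm_nonneg _) (Real.sqrt_nonneg _)

@[simp] lemma qnorm_zero : qnorm (0 : G m n) = 0 := by simp [qnorm]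

lemma qnorm_horizontal (v : Fin m → ℝ) : qnorm ((v, 0) : G m n) = enorm v := by simp [qnorm]

lemma norm_fst_le_qnorm (P : G m n) : ‖P.1‖ ≤ qnorm P :=
  (norm_le_enorm _).trans (le_add_of_nonneg_right (Real.sqrt_nonneg _))

lemma sqrt_norm_snd_le_qnorm (P : G m n) : √‖P.2‖ ≤ qnorm P :=
  (Real.sqrt_le_sqrt (norm_le_enorm _)).trans (le_add_of_nonneg_left (enorm_nonneg _))

lemma continuous_qnorm : Continuous (qnorm : G m n → ℝ) :=
  (continuous_enorm.comp continuous_fst).add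
    (Real.continuous_sqrt.comp (continuous_enorm.comp continuous_snd))

lemma comap_qnorm_nhds_zero_le : comap (qnorm : G m n → ℝ) (𝓝 0) ≤ 𝓝 0 := by
  have hq : Tendsto (qnorm : G m n → ℝ) (comap qnorm (𝓝 0)) (𝓝 0) := tendsto_comap
  have h1 : Tendsto (fun P : G m n => P.1) (comap qnorm (𝓝 0)) (𝓝 0) :=
    squeeze_zero_norm norm_fst_le_qnorm hq
  have h2 : Tendsto (fun P : G m n => P.2) (comap qnorm (𝓝 0)) (𝓝 0) := by
    have hsq : Tendsto (fun P : G m n => qnorm P ^ 2) (comap qnorm (𝓝 0)) (𝓝 0) := by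
      simpa using hq.pow 2
    exact squeeze_zero_norm
      (fun P => (Real.sqrt_le_left (qnorm_nonneg P)).1 (sqrt_norm_snd_le_qnorm P)) hsq
  exact h1.prodMk_nhds h2

end NormComparison

section GroupLaw

variable {m n k : ℕ} (b : Fin n → Matrix (Fin m) (Fin m) ℝ)

/-- The `ℝ^n`-valued form `(u, v) ↦ ⟨Bu, v⟩`. -/
def bform (u v : Fin m → ℝ) : Fin n → ℝ := fun s => ∑ i, ∑ j, b s i j * u j * v i

lemma gmul_eq (P Q : G m n) :
    gmul b P Q = (P.1 + Q.1, P.2 + Q.2 + (1 / 2 : ℝ) • bform b P.1 Q.1) := rfl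

lemma bform_add_left (u v w : Fin m → ℝ) :
    bform b (u + v) w = bform b u w + bform b v w := by
  ext s
  simp [bform, mul_add, add_mul, Finset.sum_add_distrib]

lemma bform_add_right (u v w : Fin m → ℝ) :
    bform b u (v + w) = bform b u v + bform b u w := by
  ext s
  simp [bform, mul_add, Finset.sum_add_distrib]

lemma bform_smul_left (t : ℝ) (u v : Fin m → ℝ) : bform b (t • u) v = t • bform b u v := by
  ext s
  simp only [bform, Pi.smul_apply, smul_eq_mul, Finset.mul_sum]
  exact Finset.sum_congr rfl fun i _ => Finset.sum_congr rfl fun j _ => by ring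

lemma bform_smul_right (t : ℝ) (u v : Fin m → ℝ) : bform b u (t • v) = t • bform b u v := by
  ext s
  simp only [bform, Pi.smul_apply, smul_eq_mul, Finset.mul_sum]
  exact Finset.sum_congr rfl fun i _ => Finset.sum_congr rfl fun j _ => by ring

lemma bform_neg_left (u v : Fin m → ℝ) : bform b (-u) v = -bform b u v := by
  simpa using bform_smul_left b (-1) u v

lemma bform_neg_right (u v : Fin m → ℝ) : bform b u (-v) = -bform b u v := by
  simpa using bform_smul_right b (-1) u v

@[simp] lemma bform_zero_left (v : Fin m → ℝ) : bform b 0 v = 0 := by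
  simpa using bform_smul_left b 0 0 v

@[simp] lemma bform_zero_right (v : Fin m → ℝ) : bform b v 0 = 0 := by
  simpa using bform_smul_right b 0 v 0

lemma bform_swap (hskew : ∀ s, (b s).transpose = -(b s)) (u v : Fin m → ℝ) :
    bform b v u = -bform b u v := by
  ext s
  simp only [bform, Pi.neg_apply]
  rw [Finset.sum_comm, ← Finset.sum_neg_distrib]
  refine Finset.sum_congr rfl fun i _ => ?_
  rw [← Finset.sum_neg_distrib]
  refine Finset.sum_congr rfl fun j _ => ?_
  have h : b s j i = -b s i j := congrFun (congrFun (hskew s) i) j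
  rw [h]
  ring

lemma bform_self (hskew : ∀ s, (b s).transpose = -(b s)) (u : Fin m → ℝ) : bform b u u = 0 :=
  self_eq_neg.1 (bform_swap b hskew u u)

lemma bform_single_single (s : Fin n) (i j : Fin m) (x y : ℝ) :
    bform b (Pi.single j x) (Pi.single i y) s = x * y * b s i j := by
  simp only [bform]
  rw [Finset.sum_eq_single i, Finset.sum_eq_single j]
  · simp
    ring
  · intro l _ hl
    simp [hl]
  · simp
  · intro l _ hl
    simp [hl]
  · simp

lemma continuous_gmul : Continuous fun p : G m n × G m n => gmul b p.1 p.2 := by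
  unfold gmul
  fun_prop

lemma gmul_assoc (P Q R : G m n) : gmul b (gmul b P Q) R = gmul b P (gmul b Q R) := by
  simp only [gmul_eq, bform_add_left, bform_add_right]
  ext i
  · simp [add_assoc]
  · simp
    ring

@[simp] lemma gmul_zero (P : G m n) : gmul b P 0 = P := by
  simp [gmul_eq]

@[simp] lemma zero_gmul (P : G m n) : gmul b 0 P = P := by
  simp [gmul_eq]

lemma gmul_ginv (hskew : ∀ s, (b s).transpose = -(b s)) (P : G m n) :
    gmul b P (ginv P) = 0 := by
  simp [gmul_eq, ginv, bform_neg_right, bform_self b hskew]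

lemma ginv_gmul (hskew : ∀ s, (b s).transpose = -(b s)) (P : G m n) :
    gmul b (ginv P) P = 0 := by
  simp [gmul_eq, ginv, bform_neg_left, bform_self b hskew]

lemma gmul_ginv_cancel_left (hskew : ∀ s, (b s).transpose = -(b s)) (P Q : G m n) :
    gmul b P (gmul b (ginv P) Q) = Q := by
  rw [← gmul_assoc, gmul_ginv b hskew, zero_gmul]

lemma ginv_gmul_cancel_left (hskew : ∀ s, (b s).transpose = -(b s)) (P Q : G m n) :
    gmul b (ginv P) (gmul b P Q) = Q := by
  rw [← gmul_assoc, ginv_gmul b hskew, zero_gmul]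

lemma gmul_horizontal {u v : Fin m → ℝ} (h : bform b u v = 0) :
    gmul b (u, 0) (v, 0) = (u + v, 0) := by
  simp [gmul_eq, h]

lemma gmul_vertical (x y : Fin n → ℝ) : gmul b (0, x) (0, y) = (0, x + y) := by
  simp [gmul_eq]

lemma gmul_horizontal_vertical (x : Fin m → ℝ) (y : Fin n → ℝ) :
    gmul b (x, 0) (0, y) = (x, y) := by
  simp [gmul_eq]

lemma gmul_commutator (hskew : ∀ s, (b s).transpose = -(b s)) (u v : Fin m → ℝ) :
    gmul b (gmul b (u, 0) (v, 0)) (gmul b (-u, 0) (-v, 0)) = (0, bform b u v) := by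
  simp only [gmul_eq, bform_add_left, bform_add_right, bform_neg_right, bform_neg_left,
    bform_self b hskew, bform_swap b hskew u v]
  ext i
  · simp
    ring
  · simp
    ring

lemma embH_fst_sub (v w : Fin k → ℝ) :
    (embH m n k (v - w)).1 = (embH m n k v).1 - (embH m n k w).1 := by
  ext j
  simp only [embH, Pi.sub_apply]
  split_ifs <;> simp

lemma norm_embH_fst_le (v : Fin k → ℝ) : ‖(embH m n k v).1‖ ≤ ‖v‖ := by
  refine (pi_norm_le_iff_of_nonneg (norm_nonneg v)).2 fun j => ?_
  simp only [embH]
  split_ifs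
  · exact norm_le_pi_norm v _
  · simp

lemma continuous_embH : Continuous (embH m n k) := by
  refine (continuous_pi fun j => ?_).prodMk continuous_const
  split_ifs <;> fun_prop

lemma continuous_embW : Continuous (embW m n k) := by
  refine (continuous_pi fun j => ?_).prodMk continuous_snd
  split_ifs <;> fun_prop

lemma bform_embH
    (hblock : ∀ s (i j : Fin m), (i : ℕ) < k → (j : ℕ) < k → b s i j = 0) (v w : Fin k → ℝ) :
    bform b (embH m n k v).1 (embH m n k w).1 = 0 := by
  ext s
  refine Finset.sum_eq_zero fun i _ => Finset.sum_eq_zero fun j _ => ?_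
  by_cases hi : (i : ℕ) < k
  · by_cases hj : (j : ℕ) < k
    · simp [hblock s i j hi hj]
    · simp [embH, hj]
  · simp [embH, hi]

lemma gmul_embH
    (hblock : ∀ s (i j : Fin m), (i : ℕ) < k → (j : ℕ) < k → b s i j = 0)
    (P : G m n) (v w : Fin k → ℝ) :
    gmul b (gmul b P (embH m n k v)) (embH m n k (w - v)) = gmul b P (embH m n k w) := by
  rw [gmul_assoc]
  congr 1
  refine (gmul_horizontal b (bform_embH b hblock v (w - v))).trans ?_
  rw [embH_fst_sub, add_sub_cancel]
  rfl

/-- The coordinates of `(x, y)` in the normal complement. -/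
def projW (m n k : ℕ) (P : G m n) : W m n k :=
  (fun j => P.1 ⟨k + j, by have := j.isLt; omega⟩, P.2)

lemma continuous_projW : Continuous (projW m n k) := by
  unfold projW
  fun_prop

lemma projW_embW (A : W m n k) : projW m n k (embW m n k A) = A := by
  ext j
  · simp [projW, embW]
  · rfl

lemma eq_of_gmul_embW_embH_eq (hkm : k ≤ m) {A A' : W m n k} {v v' : Fin k → ℝ}
    (h : gmul b (embW m n k A) (embH m n k v) = gmul b (embW m n k A') (embH m n k v')) :
    A = A' ∧ v = v' := by
  rw [gmul_eq, gmul_eq, Prod.mk.injEq] at h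
  obtain ⟨h1, h2⟩ := h
  have hv : v = v' := by
    ext j
    have := congrFun h1 (Fin.castLE hkm j)
    simpa [embW, embH] using this
  have hA : A.1 = A'.1 := by
    ext j
    have := congrFun h1 ⟨k + j, by have := j.isLt; omega⟩
    simpa [embW, embH] using this
  have hW : (embW m n k A).1 = (embW m n k A').1 := by simp only [embW, hA]
  subst hv
  rw [hW] at h2
  have hA2 : A.2 = A'.2 := by simpa [embW, embH] using h2
  exact ⟨Prod.ext hA hA2, rfl⟩

lemma gmul_graphMap_sigma_element (hskew : ∀ s, (b s).transpose = -(b s))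
    (P Q R : G m n) :
    gmul b (gmul b P R) (gmul b (gmul b (gmul b (ginv R) (ginv P)) Q) R) = gmul b Q R := by
  simp only [gmul_assoc, gmul_ginv_cancel_left b hskew]

end GroupLaw

section HorizontalCalculus

variable {m n k : ℕ} {b : Fin n → Matrix (Fin m) (Fin m) ℝ} {U : Set (G m n)}
  {f : G m n → Fin k → ℝ} {gradf : G m n → Matrix (Fin k) (Fin m) ℝ}

lemma gmul_horizontal_line (hskew : ∀ s, (b s).transpose = -(b s)) (P : G m n)
    (v : Fin m → ℝ) (t t' : ℝ) :
    gmul b P (t' • v, 0) = gmul b (gmul b P (t • v, 0)) ((t' - t) • v, 0) := by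
  rw [gmul_assoc, gmul_horizontal, ← add_smul, add_sub_cancel]
  rw [bform_smul_left, bform_smul_right, bform_self b hskew, smul_zero, smul_zero]

lemma C1G.hasDerivWithinAt_line (hskew : ∀ s, (b s).transpose = -(b s))
    (hf : C1G m n k b U f gradf) {P : G m n} {v : Fin m → ℝ} {S : Set ℝ}
    (hU : ∀ t ∈ S, gmul b P (t • v, 0) ∈ U) {t : ℝ} (ht : t ∈ S) :
    HasDerivWithinAt (fun t : ℝ => f (gmul b P (t • v, 0)))
      ((gradf (gmul b P (t • v, 0))).mulVec v) S t := by
  rw [hasDerivWithinAt_iff_isLittleO, Asymptotics.isLittleO_iff]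
  intro c hc
  have hv : 0 < enorm v + 1 := by linarith [enorm_nonneg v]
  obtain ⟨r, hr, H⟩ := hf.2.2 _ (hU t ht) (c / (enorm v + 1)) (by positivity)
  have hnear : ∀ᶠ t' in 𝓝[S] t, |t' - t| * enorm v < r := by
    have hc : Continuous fun t' : ℝ => |t' - t| * enorm v := by fun_prop
    exact nhdsWithin_le_nhds (hc.continuousAt.eventually_lt continuousAt_const (by simpa using hr))
  filter_upwards [hnear, self_mem_nhdsWithin] with t' ht' htS
  have hq : qnorm (gmul b (ginv (gmul b P (t • v, 0))) (gmul b P (t' • v, 0))) =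
      |t' - t| * enorm v := by
    rw [gmul_horizontal_line hskew P v t t', ginv_gmul_cancel_left b hskew, qnorm_horizontal,
      enorm_smul]
  have h := H _ (hU t' htS) (by rwa [hq])
  rw [hq] at h
  refine le_trans (le_of_eq_of_le (congrArg norm ?_) (norm_le_enorm _)) (h.trans ?_)
  · ext j
    simp only [Pi.sub_apply, Pi.smul_apply, smul_eq_mul, Matrix.mulVec, dotProduct,
      Finset.mul_sum]
    congr 1
    refine Finset.sum_congr rfl fun i _ => ?_
    simp only [gmul, Pi.add_apply, Pi.smul_apply, smul_eq_mul]
    ring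
  · rw [Real.norm_eq_abs, div_mul_eq_mul_div, div_le_iff₀ hv]
    nlinarith [mul_nonneg hc.le (abs_nonneg (t' - t))]

lemma C1G.norm_sub_sub_mulVec_le (hskew : ∀ s, (b s).transpose = -(b s))
    (hf : C1G m n k b U f gradf) {P : G m n} {v : Fin m → ℝ} (L : Matrix (Fin k) (Fin m) ℝ)
    {C : ℝ} (hU : ∀ t ∈ Icc (0 : ℝ) 1, gmul b P (t • v, 0) ∈ U)
    (hC : ∀ t ∈ Icc (0 : ℝ) 1, ‖(gradf (gmul b P (t • v, 0)) - L).mulVec v‖ ≤ C) :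
    ‖f (gmul b P (v, 0)) - f P - L.mulVec v‖ ≤ C := by
  have hd : ∀ t ∈ Icc (0 : ℝ) 1,
      HasDerivWithinAt (fun t : ℝ => f (gmul b P (t • v, 0)) - t • L.mulVec v)
        ((gradf (gmul b P (t • v, 0)) - L).mulVec v) (Icc 0 1) t := by
    intro t ht
    rw [Matrix.sub_mulVec]
    refine (hf.hasDerivWithinAt_line hskew hU ht).sub ?_
    simpa using ((hasDerivAt_id t).smul_const (L.mulVec v)).hasDerivWithinAt
  have h := norm_image_sub_le_of_norm_deriv_le_segment_01' hd
    fun t ht => hC t (Ico_subset_Icc_self ht)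
  have h0 : ((0, 0) : G m n) = 0 := rfl
  simp only [one_smul, zero_smul, h0, gmul_zero, sub_zero] at h
  rwa [sub_right_comm] at h

lemma eventually_norm_sub_mulVec_le {X : Type*} [TopologicalSpace X]
    {g : X → Matrix (Fin k) (Fin m) ℝ} {x₀ : X} (hg : ContinuousAt g x₀) {ε : ℝ} (hε : 0 < ε) :
    ∀ᶠ x in 𝓝 x₀, ∀ v, ‖(g x - g x₀).mulVec v‖ ≤ ε * ‖v‖ := by
  let Λ : Matrix (Fin k) (Fin m) ℝ →ₗ[ℝ] ((Fin m → ℝ) →L[ℝ] (Fin k → ℝ)) :=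
    LinearMap.toContinuousLinearMap.toLinearMap ∘ₗ Matrix.toLin'.toLinearMap
  have hΛ : Continuous Λ := Λ.continuous_of_finiteDimensional
  have hc : ContinuousAt (fun x => ‖Λ (g x - g x₀)‖) x₀ :=
    (hΛ.continuousAt.comp (hg.sub continuousAt_const)).norm
  filter_upwards [hc.eventually_lt continuousAt_const (by simpa using hε)] with x hx v
  exact (Λ (g x - g x₀)).le_of_opNorm_le hx.le v

/-- Strict differentiability of a `C¹_G` map along horizontal directions. -/
lemma C1G.eventually_norm_sub_sub_mulVec_le (hskew : ∀ s, (b s).transpose = -(b s))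
    (hf : C1G m n k b U f gradf) (hU : IsOpen U) {P₀ : G m n} (hP₀ : P₀ ∈ U)
    {ε : ℝ} (hε : 0 < ε) :
    ∀ᶠ p : G m n × (Fin m → ℝ) in 𝓝 P₀ ×ˢ 𝓝 0,
      ‖f (gmul b p.1 (p.2, 0)) - f p.1 - (gradf P₀).mulVec p.2‖ ≤ ε * ‖p.2‖ := by
  have hUn := hU.mem_nhds hP₀
  have hgood : ∀ᶠ Q in 𝓝 P₀, Q ∈ U ∧ ∀ v, ‖(gradf Q - gradf P₀).mulVec v‖ ≤ ε * ‖v‖ :=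
    (eventually_mem_set.2 hUn).and
      (eventually_norm_sub_mulVec_le (hf.2.1.continuousAt hUn) hε)
  have hmul : Tendsto (fun p : G m n × (Fin m → ℝ) => gmul b p.1 (p.2, 0))
      (𝓝 P₀ ×ˢ 𝓝 0) (𝓝 P₀) := by
    have hc : Continuous fun p : G m n × (Fin m → ℝ) => gmul b p.1 (p.2, 0) :=
      (continuous_gmul b).comp
        (by fun_prop : Continuous fun p : G m n × (Fin m → ℝ) => (p.1, ((p.2, 0) : G m n)))
    have h0 : ((0, 0) : G m n) = 0 := rfl
    simpa [nhds_prod_eq, h0] using hc.tendsto (P₀, 0)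
  obtain ⟨pa, hpa, pb, hpb, H⟩ := eventually_prod_iff.1 (hmul.eventually hgood)
  obtain ⟨ρ, hρ, hball⟩ := Metric.eventually_nhds_iff.1 hpb
  refine eventually_prod_iff.2 ⟨pa, hpa, fun v => dist v 0 < ρ,
    Metric.eventually_nhds_iff.2 ⟨ρ, hρ, fun _ h => h⟩, fun {P} hP {v} hv => ?_⟩
  have hseg : ∀ t ∈ Icc (0 : ℝ) 1, pb (t • v) := by
    intro t ht
    refine hball (lt_of_le_of_lt ?_ hv)
    rw [dist_zero_right, dist_zero_right, norm_smul, Real.norm_of_nonneg ht.1]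
    exact mul_le_of_le_one_left (norm_nonneg v) ht.2
  exact hf.norm_sub_sub_mulVec_le hskew _ (fun t ht => (H hP (hseg t ht)).1)
    fun t ht => (H hP (hseg t ht)).2 v

end HorizontalCalculus

section LocalLipschitz

variable {m n k : ℕ} {b : Fin n → Matrix (Fin m) (Fin m) ℝ}
  {f : G m n → Fin k → ℝ} {P₀ : G m n}

/-- Right translation by `γ z` changes `f` near `P₀` by at most a constant multiple of the
quasi-norm of `z`, for `z` near the identity. -/
def LipAlong (b : Fin n → Matrix (Fin m) (Fin m) ℝ) (f : G m n → Fin k → ℝ) (P₀ : G m n)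
    (γ : G m n → G m n) : Prop :=
  Tendsto γ (𝓝 0) (𝓝 0) ∧ ∃ C : ℝ,
    ∀ᶠ p : G m n × G m n in 𝓝 P₀ ×ˢ 𝓝 0, ‖f (gmul b p.1 (γ p.2)) - f p.1‖ ≤ C * qnorm p.2

lemma LipAlong.zero : LipAlong b f P₀ fun _ => 0 :=
  ⟨tendsto_const_nhds, 0, by simp⟩

lemma LipAlong.gmul {γ η : G m n → G m n} (hγ : LipAlong b f P₀ γ) (hη : LipAlong b f P₀ η) :
    LipAlong b f P₀ fun z => gmul b (γ z) (η z) := by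
  obtain ⟨hγ0, C, hC⟩ := hγ
  obtain ⟨hη0, D, hD⟩ := hη
  refine ⟨?_, C + D, ?_⟩
  · have h := (continuous_gmul b).tendsto (0, 0)
    rw [nhds_prod_eq, gmul_zero] at h
    exact h.comp (hγ0.prodMk hη0)
  · have hshift : Tendsto (fun p : G m n × G m n => (Carnot.gmul b p.1 (γ p.2), p.2))
        (𝓝 P₀ ×ˢ 𝓝 0) (𝓝 P₀ ×ˢ 𝓝 0) := by
      have h := (continuous_gmul b).tendsto (P₀, 0)
      rw [nhds_prod_eq, gmul_zero] at h
      exact (h.comp (tendsto_fst.prodMk (hγ0.comp tendsto_snd))).prodMk tendsto_snd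
    filter_upwards [hC, hshift.eventually hD] with p h1 h2
    rw [gmul_assoc] at h2
    calc ‖f (Carnot.gmul b p.1 (Carnot.gmul b (γ p.2) (η p.2))) - f p.1‖ ≤ _ :=
          norm_sub_le_norm_sub_add_norm_sub _ (f (Carnot.gmul b p.1 (γ p.2))) _
      _ ≤ (C + D) * qnorm p.2 := by linarith

lemma LipAlong.horizontal {K : ℝ}
    (hK : ∀ᶠ p : G m n × (Fin m → ℝ) in 𝓝 P₀ ×ˢ 𝓝 0,
      ‖f (Carnot.gmul b p.1 (p.2, 0)) - f p.1‖ ≤ K * ‖p.2‖)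
    {v : G m n → Fin m → ℝ} {C : ℝ} (hv : ∀ z, ‖v z‖ ≤ C * qnorm z) :
    LipAlong b f P₀ fun z => (v z, 0) := by
  have hv0 : Tendsto v (𝓝 0) (𝓝 0) := by
    refine squeeze_zero_norm hv ?_
    simpa using (continuous_qnorm.tendsto (0 : G m n)).const_mul C
  refine ⟨hv0.prodMk_nhds tendsto_const_nhds, |K| * C, ?_⟩
  have hshift : Tendsto (fun p : G m n × G m n => (p.1, v p.2)) (𝓝 P₀ ×ˢ 𝓝 0)
      (𝓝 P₀ ×ˢ 𝓝 0) := tendsto_fst.prodMk (hv0.comp tendsto_snd)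
  filter_upwards [hshift.eventually hK] with p hp
  calc _ ≤ K * ‖v p.2‖ := hp
    _ ≤ |K| * ‖v p.2‖ := by gcongr; exact le_abs_self K
    _ ≤ |K| * (C * qnorm p.2) := by gcongr; exact hv _
    _ = |K| * C * qnorm p.2 := by ring

lemma exists_mul_eq_and_abs_eq_sqrt (c : ℝ) : ∃ x y : ℝ, x * y = c ∧ |x| = √|c| ∧ |y| = √|c| := by
  rcases le_total 0 c with h | h
  · exact ⟨√|c|, √|c|, by rw [Real.mul_self_sqrt (abs_nonneg c), abs_of_nonneg h],
      abs_of_nonneg (Real.sqrt_nonneg _), abs_of_nonneg (Real.sqrt_nonneg _)⟩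
  · refine ⟨√|c|, -√|c|, ?_, abs_of_nonneg (Real.sqrt_nonneg _), ?_⟩
    · rw [mul_neg, Real.mul_self_sqrt (abs_nonneg c), abs_of_nonpos h, neg_neg]
    · rw [abs_neg, abs_of_nonneg (Real.sqrt_nonneg _)]

lemma LipAlong.vertical_single (hskew : ∀ s, (b s).transpose = -(b s)) {K : ℝ}
    (hK : ∀ᶠ p : G m n × (Fin m → ℝ) in 𝓝 P₀ ×ˢ 𝓝 0,
      ‖f (Carnot.gmul b p.1 (p.2, 0)) - f p.1‖ ≤ K * ‖p.2‖)
    {c : G m n → ℝ} {C : ℝ} (hc : ∀ z, √|c z| ≤ C * qnorm z) (i j : Fin m) :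
    LipAlong b f P₀ fun z => (0, fun s => c z * b s i j) := by
  choose x y hxy hx hy using exists_mul_eq_and_abs_eq_sqrt
  have hu : ∀ z, ‖(Pi.single j (x (c z)) : Fin m → ℝ)‖ ≤ C * qnorm z := fun z => by
    rw [Pi.norm_single, Real.norm_eq_abs, hx]
    exact hc z
  have hw : ∀ z, ‖(Pi.single i (y (c z)) : Fin m → ℝ)‖ ≤ C * qnorm z := fun z => by
    rw [Pi.norm_single, Real.norm_eq_abs, hy]
    exact hc z
  have h := ((LipAlong.horizontal hK hu).gmul (LipAlong.horizontal hK hw)).gmul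
    ((LipAlong.horizontal hK fun z => (norm_neg _).trans_le (hu z)).gmul
      (LipAlong.horizontal hK fun z => (norm_neg _).trans_le (hw z)))
  convert h using 2 with z
  rw [gmul_commutator b hskew]
  congr 1
  ext s
  rw [bform_single_single, hxy]

lemma LipAlong.vertical_sum (hskew : ∀ s, (b s).transpose = -(b s)) {K : ℝ}
    (hK : ∀ᶠ p : G m n × (Fin m → ℝ) in 𝓝 P₀ ×ˢ 𝓝 0,
      ‖f (Carnot.gmul b p.1 (p.2, 0)) - f p.1‖ ≤ K * ‖p.2‖)
    {c : G m n → Fin m × Fin m → ℝ} {C : ℝ} (hc : ∀ z q, √|c z q| ≤ C * qnorm z)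
    (T : Finset (Fin m × Fin m)) :
    LipAlong b f P₀ fun z => (0, ∑ q ∈ T, fun s => c z q * b s q.1 q.2) := by
  classical
  induction T using Finset.induction_on with
  | empty => exact LipAlong.zero
  | insert q T hq ih =>
    have h := (LipAlong.vertical_single hskew hK (fun z => hc z q) q.1 q.2).gmul ih
    simpa only [Finset.sum_insert hq, gmul_vertical] using h

lemma exists_coeff_of_linearIndependent (hind : LinearIndependent ℝ b) :
    ∃ c : (Fin n → ℝ) →L[ℝ] (Fin m × Fin m → ℝ),
      ∀ y, (∑ q, fun s => c y q * b s q.1 q.2) = y := by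
  let M : Matrix (Fin n) (Fin m × Fin m) ℝ := fun s q => b s q.1 q.2
  have hM : LinearIndependent ℝ M :=
    hind.map' (LinearEquiv.curry ℝ ℝ (Fin m) (Fin m)).symm.toLinearMap
      (LinearEquiv.ker _)
  have htop : LinearMap.range M.mulVecLin = ⊤ := by
    refine Submodule.eq_top_of_finrank_eq ?_
    rw [Module.finrank_fin_fun]
    simpa [Matrix.rank] using hM.rank_matrix
  obtain ⟨g, hg⟩ := M.mulVecLin.exists_rightInverse_of_surjective htop
  refine ⟨LinearMap.toContinuousLinearMap g, fun y => ?_⟩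
  ext s
  have h := congrFun (LinearMap.congr_fun hg y) s
  rw [Finset.sum_apply]
  refine Eq.trans (Finset.sum_congr rfl fun q _ => mul_comm _ _) h

/-- A `C¹_G` map is locally Lipschitz with respect to the quasi-norm. -/
lemma C1G.exists_lipschitz {U : Set (G m n)} {gradf : G m n → Matrix (Fin k) (Fin m) ℝ}
    (hskew : ∀ s, (b s).transpose = -(b s)) (hind : LinearIndependent ℝ b)
    (hf : C1G m n k b U f gradf) (hU : IsOpen U) (hP₀ : P₀ ∈ U) :
    ∃ C : ℝ, ∀ᶠ p : G m n × G m n in 𝓝 P₀ ×ˢ 𝓝 0,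
      ‖f (gmul b p.1 p.2) - f p.1‖ ≤ C * qnorm p.2 := by
  let L := LinearMap.toContinuousLinearMap (Matrix.toLin' (gradf P₀))
  have hK : ∀ᶠ p : G m n × (Fin m → ℝ) in 𝓝 P₀ ×ˢ 𝓝 0,
      ‖f (gmul b p.1 (p.2, 0)) - f p.1‖ ≤ (1 + ‖L‖) * ‖p.2‖ := by
    filter_upwards [hf.eventually_norm_sub_sub_mulVec_le hskew hU hP₀ one_pos] with p hp
    have hL : ‖(gradf P₀).mulVec p.2‖ ≤ ‖L‖ * ‖p.2‖ := L.le_opNorm p.2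
    linarith [norm_le_norm_sub_add (f (gmul b p.1 (p.2, 0)) - f p.1) ((gradf P₀).mulVec p.2)]
  obtain ⟨c, hc⟩ := exists_coeff_of_linearIndependent hind
  have hcb : ∀ (z : G m n) q, √|c z.2 q| ≤ √‖c‖ * qnorm z := fun z q => by
    calc √|c z.2 q| ≤ √(‖c‖ * ‖z.2‖) :=
          Real.sqrt_le_sqrt ((norm_le_pi_norm (c z.2) q).trans (c.le_opNorm _))
      _ = √‖c‖ * √‖z.2‖ := Real.sqrt_mul (norm_nonneg c) _
      _ ≤ √‖c‖ * qnorm z := by gcongr; exact sqrt_norm_snd_le_qnorm z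
  have h := (LipAlong.horizontal (v := Prod.fst) (C := 1) hK
    fun z => by simpa using norm_fst_le_qnorm z).gmul
      (LipAlong.vertical_sum (c := fun z => c z.2) hskew hK hcb Finset.univ)
  simp only [hc, gmul_horizontal_vertical] at h
  exact h.2

end LocalLipschitz

section ImplicitFunction

variable {m n k : ℕ} {b : Fin n → Matrix (Fin m) (Fin m) ℝ}

lemma mulVec_embH_fst (hk : k ≤ m) (gradf : G m n → Matrix (Fin k) (Fin m) ℝ) (Q : G m n)
    (v : Fin k → ℝ) :
    (gradf Q).mulVec (embH m n k v).1 = (M1 m n k hk gradf Q).mulVec v := by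
  ext j
  simp only [Matrix.mulVec, dotProduct, M1, Matrix.of_apply]
  symm
  refine Finset.sum_of_injOn (Fin.castLE hk) (Fin.castLE_injective hk).injOn (by simp) ?_ ?_
  · intro i _ hi
    have hik : ¬ (i : ℕ) < k := fun h => hi ⟨⟨i, h⟩, by simp, by ext; simp⟩
    simp [embH, hik]
  · intro i _
    simp [embH]

lemma exists_continuousLinearEquiv_eq_mulVec {M : Matrix (Fin k) (Fin k) ℝ} (hM : IsUnit M) :
    ∃ T : (Fin k → ℝ) ≃L[ℝ] (Fin k → ℝ), ∀ v, T v = M.mulVec v :=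
  ⟨(LinearEquiv.ofInjectiveEndo (Matrix.toLin' M)
    (Matrix.mulVec_injective_iff_isUnit.2 hM)).toContinuousLinearEquiv, fun _ => rfl⟩

lemma continuous_gmul_embW_embH :
    Continuous fun p : W m n k × (Fin k → ℝ) =>
      gmul b (embW m n k p.1) (embH m n k p.2) :=
  (continuous_gmul b).comp
    ((continuous_embW.comp continuous_fst).prodMk (continuous_embH.comp continuous_snd))

/-- A function whose graph is locally a zero set, non-degenerate along the fibres, is continuous
at the base point. -/
lemma continuousAt_of_graph_eq_zeroSet (hkm : k ≤ m)
    (hblock : ∀ s (i j : Fin m), (i : ℕ) < k → (j : ℕ) < k → b s i j = 0)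
    {O : Set (W m n k)} {φ : W m n k → Fin k → ℝ} {A₀ : W m n k} (hA₀ : A₀ ∈ O)
    {U : Set (G m n)} (hU : IsOpen U) (hΦU : graphMap m n k b φ A₀ ∈ U)
    {f : G m n → Fin k → ℝ} (hfc : ContinuousOn f U)
    (hgraph : ∀ P ∈ U, (P ∈ graphMap m n k b φ '' O ↔ f P = 0))
    (T : (Fin k → ℝ) ≃L[ℝ] (Fin k → ℝ))
    (hT : ∀ᶠ p : G m n × (Fin k → ℝ) in 𝓝 (graphMap m n k b φ A₀) ×ˢ 𝓝 0,
      ‖f (gmul b p.1 (embH m n k p.2)) - f p.1 - T p.2‖ ≤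
        (2 * (‖(T.symm : (Fin k → ℝ) →L[ℝ] (Fin k → ℝ))‖ + 1))⁻¹ * ‖p.2‖) :
    ContinuousAt φ A₀ := by
  set P₀ := graphMap m n k b φ A₀
  set N₀ : ℝ := ‖(T.symm : (Fin k → ℝ) →L[ℝ] (Fin k → ℝ))‖ + 1
  have hN₀pos : 0 < N₀ := by positivity
  let g : W m n k → (Fin k → ℝ) → G m n := fun A x => gmul b (embW m n k A) (embH m n k x)
  have hg : Continuous fun p : W m n k × (Fin k → ℝ) => g p.1 p.2 := continuous_gmul_embW_embH
  have hpull : Tendsto (fun p : W m n k × (Fin k → ℝ) × (Fin k → ℝ) =>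
      (g p.1 p.2.1, p.2.2 - p.2.1)) (𝓝 A₀ ×ˢ 𝓝 (φ A₀, φ A₀)) (𝓝 P₀ ×ˢ 𝓝 0) := by
    have hc : Continuous fun p : W m n k × (Fin k → ℝ) × (Fin k → ℝ) =>
        (g p.1 p.2.1, p.2.2 - p.2.1) :=
      (hg.comp (continuous_fst.prodMk (continuous_fst.comp continuous_snd))).prodMk (by fun_prop)
    have h := hc.tendsto (A₀, φ A₀, φ A₀)
    simp only [sub_self] at h
    rwa [← nhds_prod_eq, ← nhds_prod_eq]
  obtain ⟨pa, hpa, pb, hpb, H⟩ := eventually_prod_iff.1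
    (hpull.eventually (hT.and (tendsto_fst.eventually (eventually_mem_set.2 (hU.mem_nhds hΦU)))))
  obtain ⟨ρ, hρ, hball⟩ := Metric.eventually_nhds_iff.1 hpb
  rw [ContinuousAt, Metric.tendsto_nhds]
  intro ε hε
  set r : ℝ := min (ρ / 2) (ε / 2)
  have hrpos : 0 < r := by positivity
  have hrρ : r < ρ := (min_le_left _ _).trans_lt (half_lt_self hρ)
  have hrε : r < ε := (min_le_right _ _).trans_lt (half_lt_self hε)
  have hfP₀ : f P₀ = 0 := (hgraph P₀ hΦU).1 ⟨A₀, hA₀, rfl⟩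
  have hsmall : ∀ᶠ A in 𝓝 A₀, ‖f (g A (φ A₀))‖ < (2 * N₀)⁻¹ * r := by
    have hgA : ContinuousAt (fun A => g A (φ A₀)) A₀ :=
      (hg.comp (continuous_id.prodMk continuous_const)).continuousAt
    have hfg : ContinuousAt (fun A => f (g A (φ A₀))) A₀ :=
      ContinuousAt.comp (f := fun A => g A (φ A₀)) (hfc.continuousAt (hU.mem_nhds hΦU)) hgA
    refine hfg.norm.eventually_lt continuousAt_const ?_
    change ‖f P₀‖ < _
    rw [hfP₀, norm_zero]
    positivity
  filter_upwards [hpa, hsmall] with A hA hAs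
  have hx : ∀ x ∈ Metric.closedBall (φ A₀) r, ∀ y ∈ Metric.closedBall (φ A₀) r, pb (x, y) := by
    intro x hx y hy
    refine hball ?_
    rw [Prod.dist_eq]
    exact max_lt (lt_of_le_of_lt hx hrρ) (lt_of_le_of_lt hy hrρ)
  have happrox : ApproximatesLinearOn (fun x => f (g A x))
      (T : (Fin k → ℝ) →L[ℝ] (Fin k → ℝ)) (Metric.closedBall (φ A₀) r)
      (Real.toNNReal (2 * N₀)⁻¹) := by
    intro x hx' y hy'
    have h := (H hA (hx y hy' x hx')).1
    simp only [g, gmul_embH b hblock] at h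
    rw [Real.coe_toNNReal _ (by positivity)]
    exact h
  let R : (T : (Fin k → ℝ) →L[ℝ] (Fin k → ℝ)).NonlinearRightInverse :=
    { toFun := T.symm
      nnnorm := ‖(T.symm : (Fin k → ℝ) →L[ℝ] (Fin k → ℝ))‖₊ + 1
      bound' := fun y => by
        have h := (T.symm : (Fin k → ℝ) →L[ℝ] (Fin k → ℝ)).le_opNorm y
        refine h.trans ?_
        gcongr
        simp
      right_inv' := T.apply_symm_apply }
  have hsurj := happrox.surjOn_closedBall_of_nonlinearRightInverse R hrpos.le subset_rfl
  have hrad : ((R.nnnorm : ℝ)⁻¹ - (Real.toNNReal (2 * N₀)⁻¹ : ℝ)) = (2 * N₀)⁻¹ := by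
    rw [Real.coe_toNNReal _ (by positivity)]
    change N₀⁻¹ - (2 * N₀)⁻¹ = _
    field_simp
    norm_num
  rw [hrad] at hsurj
  obtain ⟨x, hxr, hfx⟩ := hsurj (a := 0) (by simpa using hAs.le)
  have hself : φ A₀ ∈ Metric.closedBall (φ A₀) r := Metric.mem_closedBall_self hrpos.le
  obtain ⟨A', -, hA'⟩ := (hgraph _ (H hA (hx x hxr _ hself)).2).2 hfx
  obtain ⟨rfl, hφ⟩ := eq_of_gmul_embW_embH_eq b hkm hA'
  rw [hφ]
  exact lt_of_le_of_lt hxr hrε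

lemma comap_dW_nhds_zero_le (hskew : ∀ s, (b s).transpose = -(b s)) (A₀ : W m n k) :
    comap (dW m n k b A₀) (𝓝 0) ≤ 𝓝 A₀ := by
  let z : W m n k → G m n := fun A => gmul b (ginv (embW m n k A₀)) (embW m n k A)
  have hz : Tendsto z (comap (dW m n k b A₀) (𝓝 0)) (𝓝 0) := by
    have hd : dW m n k b A₀ = qnorm ∘ z := rfl
    rw [hd, ← comap_comap]
    exact tendsto_comap.mono_right comap_qnorm_nhds_zero_le
  have hc : Continuous fun P => projW m n k (gmul b (embW m n k A₀) P) :=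
    continuous_projW.comp ((continuous_gmul b).comp (continuous_const.prodMk continuous_id))
  have h := (hc.tendsto 0).comp hz
  have hid : (fun P => projW m n k (gmul b (embW m n k A₀) P)) ∘ z = id := by
    ext1 A
    simp only [Function.comp_apply, z, gmul_ginv_cancel_left b hskew, projW_embW, id]
  rwa [hid, gmul_zero, projW_embW] at h

end ImplicitFunction

/-- If the intrinsic graph of `φ` is, near `Φ(A₀)`, the non-critical
zero level set of a `C¹_G` map `f` with invertible square horizontal block `M₁`,
then `φ` is intrinsic Lipschitz near `A₀`. -/
theorem statement6 (m n k : ℕ) (hm : 2 ≤ m) (hn : 1 ≤ n) (hk : 1 ≤ k) (hkm : k < m)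
    (b : Fin n → Matrix (Fin m) (Fin m) ℝ)
    (hskew : ∀ s, (b s).transpose = -(b s)) (hind : LinearIndependent ℝ b)
    (hblock : ∀ s (i j : Fin m), (i : ℕ) < k → (j : ℕ) < k → b s i j = 0)
    (O : Set (W m n k)) (hO : IsOpen O) (φ : W m n k → Fin k → ℝ)
    (A₀ : W m n k) (hA₀ : A₀ ∈ O)
    (U : Set (G m n)) (hU : IsOpen U) (hΦU : graphMap m n k b φ A₀ ∈ U)
    (f : G m n → Fin k → ℝ) (gradf : G m n → Matrix (Fin k) (Fin m) ℝ)
    (hf : C1G m n k b U f gradf)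
    (hgraph : ∀ P ∈ U, (P ∈ graphMap m n k b φ '' O ↔ f P = 0))
    (hM1 : ∀ Q ∈ U, IsUnit (M1 m n k hkm.le gradf Q)) :
    ∃ δ > 0, ∃ C : ℝ, 0 ≤ C ∧ ∀ A ∈ O, ∀ B ∈ O,
      dW m n k b A₀ A < δ → dW m n k b A₀ B < δ →
      enorm (fun j => φ B j - φ A j) ≤ C * sigma m n k b φ A B := by
  have hkm' := hkm.le
  set P₀ := graphMap m n k b φ A₀
  obtain ⟨T, hT⟩ := exists_continuousLinearEquiv_eq_mulVec (hM1 P₀ hΦU)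
  set N₀ : ℝ := ‖(T.symm : (Fin k → ℝ) →L[ℝ] (Fin k → ℝ))‖ + 1
  have hN₀pos : 0 < N₀ := by positivity
  have hH : ∀ᶠ p : G m n × (Fin k → ℝ) in 𝓝 P₀ ×ˢ 𝓝 0,
      ‖f (gmul b p.1 (embH m n k p.2)) - f p.1 - T p.2‖ ≤ (2 * N₀)⁻¹ * ‖p.2‖ := by
    have h0 : Tendsto (fun v : Fin k → ℝ => (embH m n k v).1) (𝓝 0) (𝓝 0) :=
      squeeze_zero_norm norm_embH_fst_le tendsto_norm_zero
    have hpull : Tendsto (fun p : G m n × (Fin k → ℝ) => (p.1, (embH m n k p.2).1))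
        (𝓝 P₀ ×ˢ 𝓝 0) (𝓝 P₀ ×ˢ 𝓝 0) := tendsto_fst.prodMk (h0.comp tendsto_snd)
    filter_upwards [hpull.eventually (hf.eventually_norm_sub_sub_mulVec_le hskew hU hΦU
      (by positivity : 0 < (2 * N₀)⁻¹))] with p hp
    rw [mulVec_embH_fst hkm', ← hT] at hp
    refine hp.trans ?_
    gcongr
    exact norm_embH_fst_le p.2
  have hφ : ContinuousAt φ A₀ :=
    continuousAt_of_graph_eq_zeroSet hkm' hblock hA₀ hU hΦU hf.1 hgraph T hH
  obtain ⟨C, hC⟩ := hf.exists_lipschitz hskew hind hU hΦU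
  let z : W m n k × W m n k → G m n := fun p =>
    gmul b (gmul b (gmul b (ginv (embH m n k (φ p.1))) (ginv (embW m n k p.1)))
      (embW m n k p.2)) (embH m n k (φ p.1))
  have hginv : Continuous (ginv : G m n → G m n) := by
    unfold ginv
    fun_prop
  have hφ1 : Tendsto (fun p : W m n k × W m n k => φ p.1) (𝓝 A₀ ×ˢ 𝓝 A₀) (𝓝 (φ A₀)) :=
    hφ.tendsto.comp tendsto_fst
  have hφ2 : Tendsto (fun p : W m n k × W m n k => φ p.2) (𝓝 A₀ ×ˢ 𝓝 A₀) (𝓝 (φ A₀)) :=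
    hφ.tendsto.comp tendsto_snd
  have hΦ : Tendsto (graphMap m n k b φ) (𝓝 A₀) (𝓝 P₀) :=
    ((continuous_gmul_embW_embH (b := b)).tendsto (A₀, φ A₀)).comp
      (tendsto_id.prodMk_nhds hφ.tendsto)
  have hz : Tendsto z (𝓝 A₀ ×ˢ 𝓝 A₀) (𝓝 0) := by
    have hcont : Continuous fun q : (W m n k × W m n k) × (Fin k → ℝ) =>
        gmul b (gmul b (gmul b (ginv (embH m n k q.2)) (ginv (embW m n k q.1.1)))
          (embW m n k q.1.2)) (embH m n k q.2) := by
      have hH' : Continuous fun q : (W m n k × W m n k) × (Fin k → ℝ) => embH m n k q.2 :=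
        continuous_embH.comp continuous_snd
      have hW1 : Continuous fun q : (W m n k × W m n k) × (Fin k → ℝ) => embW m n k q.1.1 :=
        continuous_embW.comp (continuous_fst.comp continuous_fst)
      have hW2 : Continuous fun q : (W m n k × W m n k) × (Fin k → ℝ) => embW m n k q.1.2 :=
        continuous_embW.comp (continuous_snd.comp continuous_fst)
      exact (continuous_gmul b).comp (((continuous_gmul b).comp (((continuous_gmul b).comp
        ((hginv.comp hH').prodMk (hginv.comp hW1))).prodMk hW2)).prodMk hH')
    have h := hcont.tendsto ((A₀, A₀), φ A₀)
    simp only [gmul_assoc, zero_gmul, ginv_gmul b hskew] at h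
    rw [nhds_prod_eq, nhds_prod_eq] at h
    simpa only [z, gmul_assoc, Function.comp_def, id] using h.comp (tendsto_id.prodMk hφ1)
  have hdiff : Tendsto (fun p : W m n k × W m n k => φ p.1 - φ p.2) (𝓝 A₀ ×ˢ 𝓝 A₀) (𝓝 0) := by
    simpa using hφ1.sub hφ2
  have hUn : ∀ᶠ P in 𝓝 P₀, P ∈ U := hU.mem_nhds hΦU
  have key : ∀ᶠ p : W m n k × W m n k in 𝓝 A₀ ×ˢ 𝓝 A₀, p.1 ∈ O → p.2 ∈ O →
      enorm (fun j => φ p.2 j - φ p.1 j) ≤ (k * (2 * N₀ * |C|)) * sigma m n k b φ p.1 p.2 := by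
    filter_upwards [((hΦ.comp tendsto_fst).prodMk hz).eventually hC,
      ((hΦ.comp tendsto_snd).prodMk hdiff).eventually hH,
      (hΦ.comp tendsto_fst).eventually hUn, (hΦ.comp tendsto_snd).eventually hUn]
      with p hLip hLin hU1 hU2 hO1 hO2
    have hf1 : f (graphMap m n k b φ p.1) = 0 := (hgraph _ hU1).1 ⟨p.1, hO1, rfl⟩
    have hf2 : f (graphMap m n k b φ p.2) = 0 := (hgraph _ hU2).1 ⟨p.2, hO2, rfl⟩
    simp only [Function.comp_apply, hf1, hf2, sub_zero] at hLip hLin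
    have e1 : gmul b (graphMap m n k b φ p.1) (z p) =
        gmul b (embW m n k p.2) (embH m n k (φ p.1)) :=
      gmul_graphMap_sigma_element b hskew _ _ _
    have e2 : gmul b (graphMap m n k b φ p.2) (embH m n k (φ p.1 - φ p.2)) =
        gmul b (embW m n k p.2) (embH m n k (φ p.1)) := gmul_embH b hblock _ _ _
    rw [e1] at hLip
    rw [e2] at hLin
    set v := φ p.1 - φ p.2
    have hsig : sigma m n k b φ p.1 p.2 = qnorm (z p) := rfl
    have hinv : ‖v‖ ≤ N₀ * ‖T v‖ := by
      have h := (T.symm : (Fin k → ℝ) →L[ℝ] (Fin k → ℝ)).le_opNorm (T v)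
      simp only [ContinuousLinearEquiv.coe_coe, T.symm_apply_apply] at h
      nlinarith [norm_nonneg (T v)]
    have hTv : ‖T v‖ ≤ (2 * N₀)⁻¹ * ‖v‖ + |C| * qnorm (z p) := by
      have h1 : C * qnorm (z p) ≤ |C| * qnorm (z p) :=
        mul_le_mul_of_nonneg_right (le_abs_self C) (qnorm_nonneg _)
      linarith [norm_le_norm_add_norm_sub (f (gmul b (embW m n k p.2) (embH m n k (φ p.1)))) (T v)]
    have hbound : ‖v‖ ≤ 2 * N₀ * |C| * qnorm (z p) := by
      have h1 : N₀ * ‖T v‖ ≤ N₀ * ((2 * N₀)⁻¹ * ‖v‖ + |C| * qnorm (z p)) := by gcongr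
      have h2 : N₀ * ((2 * N₀)⁻¹ * ‖v‖ + |C| * qnorm (z p)) =
          ‖v‖ / 2 + N₀ * |C| * qnorm (z p) := by
        field_simp
      linarith
    have hnorm : ‖fun j => φ p.2 j - φ p.1 j‖ = ‖v‖ := norm_sub_rev (φ p.2) (φ p.1)
    rw [hsig]
    calc _ ≤ k * ‖fun j => φ p.2 j - φ p.1 j‖ := enorm_le_mul_norm _
      _ ≤ k * (2 * N₀ * |C| * qnorm (z p)) := by rw [hnorm]; gcongr
      _ = _ := by ring
  obtain ⟨pa, hpa, pb, hpb, H⟩ := eventually_prod_iff.1 key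
  have hev := comap_dW_nhds_zero_le hskew A₀ (hpa.and hpb)
  obtain ⟨S, hS, hSsub⟩ := mem_comap.1 hev
  obtain ⟨δ, hδ, hball⟩ := Metric.mem_nhds_iff.1 hS
  have hmem : ∀ A, dW m n k b A₀ A < δ → pa A ∧ pb A := fun A hA => by
    refine hSsub (hball ?_)
    rw [Metric.mem_ball, Real.dist_0_eq_abs,
      abs_of_nonneg (show 0 ≤ dW m n k b A₀ A from qnorm_nonneg _)]
    exact hA
  exact ⟨δ, hδ, _, by positivity, fun A hA B hB hdA hdB =>
    H (hmem A hdA).1 (hmem B hdB).2 hA hB⟩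

end Carnot
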